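/- The exponential mechanism is ε-differentially private: let Y be a nonempty finite set, let u be a utility function mapping (finite multiset of records, element of Y) pairs to reals with sensitivity Δ_u > 0, meaning |u(D + {x}, y) − u(D, y)| ≤ Δ_u for all multisets D, records x, and y ∈ Y. For each multiset D define the probability mass function p_D(y) = exp(ε·u(D,y)/(2Δ_u)) / Σ_{y'∈Y} exp(ε·u(D,y')/(2Δ_u)). Then for every multiset D, record x, and subset S ⊆ Y, letting D' = D + {x}, we have Σ_{y∈S} p_D(y) ≤ e^ε · Σ_{y∈S} p_{D'}(y) and Σ_{y∈S} p_{D'}(y) ≤ e^ε · Σ_{y∈S} p_D(y). -/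

import Mathlib

/-- The probability that the exponential mechanism with privacy parameter `ε`, utility
function `u` of sensitivity `Δ`, and finite output set `Y` outputs `y` on database `D`. -/
noncomputable def expMechProb {X Y : Type*} [Fintype Y] (ε Δ : ℝ) (u : Multiset X → Y → ℝ)
    (D : Multiset X) (y : Y) : ℝ :=
  Real.exp (ε * u D y / (2 * Δ)) / ∑ y' : Y, Real.exp (ε * u D y' / (2 * Δ))

theorem expMech_aux {X Y : Type*} [Fintype Y] [Nonempty Y] (ε Δ : ℝ) (hε : 0 < ε)
    (hΔ : 0 < Δ) (u : Multiset X → Y → ℝ) (D D' : Multiset X)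
    (h : ∀ y, |u D y - u D' y| ≤ Δ) (S : Finset Y) :
    (∑ y ∈ S, expMechProb ε Δ u D y) ≤ Real.exp ε * ∑ y ∈ S, expMechProb ε Δ u D' y := by
  have key : ∀ a b : ℝ, a - b ≤ Δ → Real.exp (ε * a / (2 * Δ)) ≤
      Real.exp (ε / 2) * Real.exp (ε * b / (2 * Δ)) := by
    intro a b hab
    rw [← Real.exp_add, Real.exp_le_exp]
    have e : ε / 2 + ε * b / (2 * Δ) = ε * (Δ + b) / (2 * Δ) := by
      field_simp
    rw [e]
    gcongr
    linarith
  have pos : ∀ E : Multiset X, 0 < ∑ y' : Y, Real.exp (ε * u E y' / (2 * Δ)) := fun E =>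
    Finset.sum_pos (fun _ _ => Real.exp_pos _) Finset.univ_nonempty
  have hsum : ∑ y' : Y, Real.exp (ε * u D' y' / (2 * Δ)) ≤
      Real.exp (ε / 2) * ∑ y' : Y, Real.exp (ε * u D y' / (2 * Δ)) := by
    rw [Finset.mul_sum]
    exact Finset.sum_le_sum fun y _ => key _ _ (by have := (abs_le.mp (h y)).1; linarith)
  have hee : Real.exp ε = Real.exp (ε / 2) * Real.exp (ε / 2) := by
    rw [← Real.exp_add]; ring_nf
  rw [Finset.mul_sum]
  refine Finset.sum_le_sum fun y _ => ?_
  unfold expMechProb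
  rw [← mul_div_assoc, div_le_div_iff₀ (pos D) (pos D')]
  calc _ ≤ (Real.exp (ε / 2) * Real.exp (ε * u D' y / (2 * Δ))) *
        (Real.exp (ε / 2) * ∑ y' : Y, Real.exp (ε * u D y' / (2 * Δ))) :=
        mul_le_mul (key _ _ (abs_le.mp (h y)).2) hsum (pos D').le (by positivity)
    _ = _ := by rw [hee]; ring

/-- The exponential mechanism is `ε`-differentially private (add-remove model): for any
utility function of sensitivity `Δ`, any database `D`, any record `x`, and any event
`S ⊆ Y`, the probabilities of `S` on `D` and on `D + {x}` are within a factor `e^ε`. -/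
theorem expMech_dp {X Y : Type*} [Fintype Y] [Nonempty Y] (ε Δ : ℝ) (hε : 0 < ε)
    (hΔ : 0 < Δ) (u : Multiset X → Y → ℝ)
    (hsens : ∀ (D : Multiset X) (x : X) (y : Y), |u (x ::ₘ D) y - u D y| ≤ Δ)
    (D : Multiset X) (x : X) (S : Finset Y) :
    (∑ y ∈ S, expMechProb ε Δ u D y) ≤ Real.exp ε * ∑ y ∈ S, expMechProb ε Δ u (x ::ₘ D) y ∧
    (∑ y ∈ S, expMechProb ε Δ u (x ::ₘ D) y) ≤ Real.exp ε * ∑ y ∈ S, expMechProb ε Δ u D y := by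
  exact ⟨expMech_aux ε Δ hε hΔ u _ _ (fun y => by rw [abs_sub_comm]; exact hsens D x y) S,
    expMech_aux ε Δ hε hΔ u _ _ (hsens D x) S⟩
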